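/- arXiv:math/9903089 — 2 statements merged into one kernel-verified Lean document; each statement's English description precedes it below -/
import Mathlib

section
/- Let v ∈ ℝⁿ and let x ∈ ℝⁿ be an approximate continuity point of the function z ↦ ρ̲(z, v), meaning that for every ε > 0 the set Z_ε = { z ∈ ℝⁿ : |ρ̲(z, v) − ρ̲(x, v)| < ε } has Lebesgue density 1 at x (i.e. λ(Z_ε ∩ B(x, r))/λ(B(x, r)) → 1 as r → 0⁺, where λ is Lebesgue measure). Then for every τ ∈ ℝ one has ρ̄(x, τ·v) ≤ |τ| · ρ̲(x, v); in particular ρ̲(x, v) = ρ̄(x, v). -/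
open Filter Metric Set MeasureTheory

/-- Lower derivate of a distance function `d` on `ℝⁿ` at `x` in direction `v`:
`liminf_{t→0⁺} inf { d(y, y + t•v)/t : y ∈ B̄(x,t) }`. -/
noncomputable def lowerDerivate {n : ℕ}
    (d : EuclideanSpace ℝ (Fin n) → EuclideanSpace ℝ (Fin n) → ℝ)
    (x v : EuclideanSpace ℝ (Fin n)) : ℝ :=
  Filter.liminf
    (fun t : ℝ => sInf ((fun y => d y (y + t • v) / t) '' Metric.closedBall x t))
    (nhdsWithin 0 (Set.Ioi 0))

/-- Upper derivate of a distance function `d` on `ℝⁿ` at `x` in direction `v`: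
`limsup_{t→0⁺} sup { d(y, y + t•v)/t : y ∈ B̄(x,t) }`. -/
noncomputable def upperDerivate {n : ℕ}
    (d : EuclideanSpace ℝ (Fin n) → EuclideanSpace ℝ (Fin n) → ℝ)
    (x v : EuclideanSpace ℝ (Fin n)) : ℝ :=
  Filter.limsup
    (fun t : ℝ => sSup ((fun y => d y (y + t • v) / t) '' Metric.closedBall x t))
    (nhdsWithin 0 (Set.Ioi 0))

/-- A measurable set `N` meeting `Z` in a null set has measure at most `η * μ B` inside `B`
whenever `Z` fills a proportion `1 - η` of `B`; here `Z` need not be measurable. -/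
theorem measureReal_inter_le_of_ae_notMem {α : Type*} [MeasurableSpace α] {μ : Measure α}
    {N Z B : Set α} (hN : MeasurableSet N) (hNZ : ∀ᵐ z ∂μ, z ∈ Z → z ∉ N) (hB : μ B ≠ ⊤) {η : ℝ}
    (hη : (1 - η) * μ.real B ≤ μ.real (Z ∩ B)) : μ.real (B ∩ N) ≤ η * μ.real B := by
  have hle : μ.real (Z ∩ B) ≤ μ.real (B \ N) := by
    refine ENNReal.toReal_mono (measure_ne_top_of_subset sdiff_subset hB) (measure_mono_ae ?_)
    filter_upwards [hNZ] with z hz hzB using ⟨hzB.2, hz hzB.1⟩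
  linarith [measureReal_inter_add_sdiff (μ := μ) (s := B) hN hB]

/-- The increment of a Lipschitz function along `T • v`, integrated over `S`, is controlled by the
integrals of its derivative over the translates of `S`. -/
theorem norm_setIntegral_translate_sub_le {E : Type*} [NormedAddCommGroup E] [NormedSpace ℝ E]
    [FiniteDimensional ℝ E] [MeasurableSpace E] [BorelSpace E] (μ : Measure E)
    [μ.IsAddHaarMeasure] {φ : E → ℝ} {K : NNReal} (hφ : LipschitzWith K φ) (v : E) {S : Set E}
    (hS : μ S ≠ ⊤) (T M : ℝ)
    (hM : ∀ s : ℝ, |s| ≤ |T| → ∫ w in S, ‖fderiv ℝ φ (w + s • v) v‖ ∂μ ≤ M) :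
    ‖∫ w in S, (φ (w + T • v) - φ w) ∂μ‖ ≤ M * |T| := by
  have : IsFiniteMeasure (μ.restrict S) := ⟨by simpa using hS.lt_top⟩
  have hlip : ∀ w, LipschitzWith (K * ‖v‖₊) fun s : ℝ => φ (w + s • v) - φ w := fun w =>
    LipschitzWith.of_dist_le_mul fun a b => by
      calc dist (φ (w + a • v) - φ w) (φ (w + b • v) - φ w)
          = dist (φ (w + a • v)) (φ (w + b • v)) := dist_sub_right _ _ _
        _ ≤ K * dist (w + a • v) (w + b • v) := hφ.dist_le_mul _ _
        _ = _ := by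
          rw [dist_add_left, dist_eq_norm, ← sub_smul, norm_smul, Real.dist_eq, Real.norm_eq_abs]
          push_cast
          ring
  have hmeas : ∀ s : ℝ, AEStronglyMeasurable (fun w => φ (w + s • v) - φ w) (μ.restrict S) :=
    fun s => ((hφ.continuous.comp (continuous_id.add continuous_const)).sub
      hφ.continuous).aestronglyMeasurable
  have hderiv : ∀ s : ℝ, HasDerivAt (fun s : ℝ => ∫ w in S, (φ (w + s • v) - φ w) ∂μ)
      (∫ w in S, fderiv ℝ φ (w + s • v) v ∂μ) s := fun s => by
    refine (hasDerivAt_integral_of_dominated_loc_of_lip (s := univ)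
      (bound := fun _ => (K * ‖v‖₊ : NNReal)) univ_mem
      (.of_forall hmeas) ?_ ?_ ?_ (integrable_const _) ?_).2
    · refine (integrable_const ((K * ‖v‖₊ : NNReal) * |s|)).mono' (hmeas s) (.of_forall fun w => ?_)
      simpa [Real.dist_eq] using (hlip w).dist_le_mul s 0
    · exact ((measurable_fderiv_apply_const ℝ φ v).comp
        (measurable_id.add_const _)).aestronglyMeasurable
    · exact .of_forall fun w => by
        simpa only [Real.nnabs_coe] using (hlip w).lipschitzOnWith
    · have := (measurePreserving_add_right μ (s • v)).quasiMeasurePreserving.ae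
        (hφ.ae_differentiableAt (μ := μ))
      filter_upwards [ae_restrict_of_ae this] with w hw
      have h1 : HasDerivAt (fun s : ℝ => w + s • v) v s := by
        simpa using ((hasDerivAt_id s).smul_const v).const_add w
      exact (hw.hasFDerivAt.comp_hasDerivAt s h1).sub_const _
  have := (convex_uIcc (0 : ℝ) T).norm_image_sub_le_of_norm_hasDerivWithin_le
    (fun s _ => (hderiv s).hasDerivWithinAt) (C := M) (fun s hs => ?_) left_mem_uIcc right_mem_uIcc
  · simpa using this
  · refine (norm_integral_le_integral_norm _).trans (hM s ?_)
    simpa using abs_sub_left_of_mem_uIcc hs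

section Derivates

variable {n : ℕ} {d : EuclideanSpace ℝ (Fin n) → EuclideanSpace ℝ (Fin n) → ℝ} {L : ℝ}

theorem quotient_mem_Icc (hnonneg : ∀ a b, 0 ≤ d a b) (hLip : ∀ a b, d a b ≤ L * ‖a - b‖)
    (y v : EuclideanSpace ℝ (Fin n)) {t : ℝ} (ht : 0 < t) :
    d y (y + t • v) / t ∈ Icc 0 (L * ‖v‖) := by
  refine ⟨div_nonneg (hnonneg _ _) ht.le, (div_le_iff₀ ht).2 ((hLip _ _).trans_eq ?_)⟩
  rw [sub_add_cancel_left, norm_neg, norm_smul, Real.norm_of_nonneg ht.le]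
  ring

theorem sInf_quotient_mem_Icc (hnonneg : ∀ a b, 0 ≤ d a b) (hLip : ∀ a b, d a b ≤ L * ‖a - b‖)
    (x v : EuclideanSpace ℝ (Fin n)) {t : ℝ} (ht : 0 < t) :
    sInf ((fun y => d y (y + t • v) / t) '' closedBall x t) ∈ Icc 0 (L * ‖v‖) := by
  have hx : x ∈ closedBall x t := mem_closedBall_self ht.le
  refine ⟨le_csInf ⟨_, mem_image_of_mem _ hx⟩ ?_, ?_⟩
  · rintro _ ⟨y, -, rfl⟩
    exact (quotient_mem_Icc hnonneg hLip y v ht).1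
  · refine (csInf_le ⟨0, ?_⟩ (mem_image_of_mem _ hx)).trans (quotient_mem_Icc hnonneg hLip x v ht).2
    rintro _ ⟨y, -, rfl⟩
    exact (quotient_mem_Icc hnonneg hLip y v ht).1

theorem sSup_quotient_mem_Icc (hnonneg : ∀ a b, 0 ≤ d a b) (hLip : ∀ a b, d a b ≤ L * ‖a - b‖)
    (x v : EuclideanSpace ℝ (Fin n)) {t : ℝ} (ht : 0 < t) :
    sSup ((fun y => d y (y + t • v) / t) '' closedBall x t) ∈ Icc 0 (L * ‖v‖) := by
  have hx : x ∈ closedBall x t := mem_closedBall_self ht.le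
  refine ⟨?_, csSup_le ⟨_, mem_image_of_mem _ hx⟩ ?_⟩
  · refine (quotient_mem_Icc hnonneg hLip x v ht).1.trans
      (le_csSup ⟨L * ‖v‖, ?_⟩ (mem_image_of_mem _ hx))
    rintro _ ⟨y, -, rfl⟩
    exact (quotient_mem_Icc hnonneg hLip y v ht).2
  · rintro _ ⟨y, -, rfl⟩
    exact (quotient_mem_Icc hnonneg hLip y v ht).2

theorem le_lowerDerivate (hnonneg : ∀ a b, 0 ≤ d a b) (hLip : ∀ a b, d a b ≤ L * ‖a - b‖)
    {x v : EuclideanSpace ℝ (Fin n)} {c : ℝ}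
    (h : ∀ᶠ t in nhdsWithin (0 : ℝ) (Ioi 0), ∀ y ∈ closedBall x t, c ≤ d y (y + t • v) / t) :
    c ≤ lowerDerivate d x v := by
  have hpos : ∀ᶠ t in nhdsWithin (0 : ℝ) (Ioi 0), 0 < t := self_mem_nhdsWithin
  refine le_liminf_of_le ?_ ?_
  · exact (isBoundedUnder_of_eventually_le (hpos.mono fun t ht =>
      (sInf_quotient_mem_Icc hnonneg hLip x v ht).2)).isCoboundedUnder_ge
  · filter_upwards [h, hpos] with t ht ht0
    refine le_csInf ⟨_, mem_image_of_mem _ (mem_closedBall_self ht0.le)⟩ ?_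
    rintro _ ⟨y, hy, rfl⟩
    exact ht y hy

theorem upperDerivate_le (hnonneg : ∀ a b, 0 ≤ d a b) (hLip : ∀ a b, d a b ≤ L * ‖a - b‖)
    {x v : EuclideanSpace ℝ (Fin n)} {c : ℝ}
    (h : ∀ᶠ t in nhdsWithin (0 : ℝ) (Ioi 0), ∀ y ∈ closedBall x t, d y (y + t • v) / t ≤ c) :
    upperDerivate d x v ≤ c := by
  have hpos : ∀ᶠ t in nhdsWithin (0 : ℝ) (Ioi 0), 0 < t := self_mem_nhdsWithin
  refine limsup_le_of_le ?_ ?_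
  · exact (isBoundedUnder_of_eventually_ge (hpos.mono fun t ht =>
      (sSup_quotient_mem_Icc hnonneg hLip x v ht).1)).isCoboundedUnder_le
  · filter_upwards [h, hpos] with t ht ht0
    refine csSup_le ⟨_, mem_image_of_mem _ (mem_closedBall_self ht0.le)⟩ ?_
    rintro _ ⟨y, hy, rfl⟩
    exact ht y hy

theorem lowerDerivate_nonneg (hnonneg : ∀ a b, 0 ≤ d a b) (hLip : ∀ a b, d a b ≤ L * ‖a - b‖)
    (x v : EuclideanSpace ℝ (Fin n)) : 0 ≤ lowerDerivate d x v :=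
  le_lowerDerivate hnonneg hLip <| mem_of_superset self_mem_nhdsWithin fun _ ht y _ =>
    (quotient_mem_Icc hnonneg hLip y v ht).1

theorem lowerDerivate_le_upperDerivate (hnonneg : ∀ a b, 0 ≤ d a b)
    (hLip : ∀ a b, d a b ≤ L * ‖a - b‖) (x v : EuclideanSpace ℝ (Fin n)) :
    lowerDerivate d x v ≤ upperDerivate d x v := by
  have hpos : ∀ᶠ t in nhdsWithin (0 : ℝ) (Ioi 0), 0 < t := self_mem_nhdsWithin
  have hinf := isBoundedUnder_of_eventually_ge (hpos.mono fun t ht =>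
    (sInf_quotient_mem_Icc hnonneg hLip x v ht).1)
  have hsup := isBoundedUnder_of_eventually_le (hpos.mono fun t ht =>
    (sSup_quotient_mem_Icc hnonneg hLip x v ht).2)
  have hsup' := isBoundedUnder_of_eventually_ge (hpos.mono fun t ht =>
    (sSup_quotient_mem_Icc hnonneg hLip x v ht).1)
  refine (liminf_le_liminf ?_ hinf hsup.isCoboundedUnder_ge).trans (liminf_le_limsup hsup hsup')
  filter_upwards [hpos] with t ht
  refine csInf_le_csSup ⟨_, mem_image_of_mem _ (mem_closedBall_self ht.le)⟩ ?_ ?_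
  · refine ⟨0, ?_⟩
    rintro _ ⟨y, -, rfl⟩
    exact (quotient_mem_Icc hnonneg hLip y v ht).1
  · refine ⟨L * ‖v‖, ?_⟩
    rintro _ ⟨y, -, rfl⟩
    exact (quotient_mem_Icc hnonneg hLip y v ht).2

/-- The directional derivative of a function that is `1`-Lipschitz for `d` is bounded by the lower
derivate of `d`. -/
theorem norm_fderiv_apply_le_lowerDerivate (hnonneg : ∀ a b, 0 ≤ d a b)
    (hLip : ∀ a b, d a b ≤ L * ‖a - b‖) {φ : EuclideanSpace ℝ (Fin n) → ℝ}
    (hφ : ∀ a b, |φ a - φ b| ≤ d a b) {z : EuclideanSpace ℝ (Fin n)} (hz : DifferentiableAt ℝ φ z)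
    (v : EuclideanSpace ℝ (Fin n)) : ‖fderiv ℝ φ z v‖ ≤ lowerDerivate d z v := by
  suffices h : ∀ κ > 0, ‖fderiv ℝ φ z v‖ - κ * (2 + ‖v‖) ≤ lowerDerivate d z v by
    refine le_of_forall_pos_le_add fun e he => ?_
    have hv : 0 < 2 + ‖v‖ := by positivity
    have := h (e / (2 + ‖v‖)) (by positivity)
    rw [div_mul_cancel₀ _ hv.ne'] at this
    linarith
  intro κ hκ
  obtain ⟨δ, hδ, hball⟩ := Metric.eventually_nhds_iff.1
    ((hasFDerivAt_iff_isLittleO.1 hz.hasFDerivAt).def hκ)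
  refine le_lowerDerivate hnonneg hLip ?_
  have hsmall : ∀ᶠ t in nhdsWithin (0 : ℝ) (Ioi 0), t * (1 + ‖v‖) < δ := by
    refine nhdsWithin_le_nhds (Tendsto.eventually_lt_const hδ ?_)
    exact (continuous_id.mul continuous_const).tendsto' _ _ (by simp)
  filter_upwards [hsmall, self_mem_nhdsWithin] with t ht (ht0 : 0 < t) y hy
  have hy1 : ‖y - z‖ ≤ t := by simpa [dist_eq_norm] using hy
  have hy2 : ‖y + t • v - z‖ ≤ t * (1 + ‖v‖) := by
    calc ‖y + t • v - z‖ = ‖(y - z) + t • v‖ := by congr 1; abel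
      _ ≤ ‖y - z‖ + ‖t • v‖ := norm_add_le _ _
      _ ≤ t * (1 + ‖v‖) := by rw [norm_smul, Real.norm_of_nonneg ht0.le]; linarith
  have h1 := hball (y := y) (by
    rw [dist_eq_norm]; nlinarith [mul_nonneg ht0.le (norm_nonneg v)])
  have h2 := hball (y := y + t • v) (by rw [dist_eq_norm]; linarith)
  have hlin : fderiv ℝ φ z (y + t • v - z) = fderiv ℝ φ z (y - z) + t * fderiv ℝ φ z v := by
    rw [← smul_eq_mul, ← map_smul, ← map_add]
    congr 1
    abel
  rw [hlin] at h2
  rw [le_div_iff₀ ht0]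
  have h3 := hφ y (y + t • v)
  have h4 := mul_le_mul_of_nonneg_left hy1 hκ.le
  have h5 := mul_le_mul_of_nonneg_left hy2 hκ.le
  have h6 : ‖fderiv ℝ φ z v‖ * t = |t * fderiv ℝ φ z v| := by
    rw [abs_mul, abs_of_pos ht0, Real.norm_eq_abs, mul_comm]
  rw [Real.norm_eq_abs] at h1 h2
  have h7 : |t * fderiv ℝ φ z v| ≤ |φ y - φ (y + t • v)| + κ * ‖y - z‖ + κ * ‖y + t • v - z‖ := by
    rw [abs_le] at h1 h2
    rw [abs_le]
    constructor <;> linarith [le_abs_self (φ y - φ (y + t • v)), neg_le_abs (φ y - φ (y + t • v))]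
  linarith

/-- If the lower derivate of `d` in direction `v` is at most `c` on most of `ball x R`, then
averaging over `ball y r` bounds `d` along the segment from `y` to `y + T • v`. -/
theorem dist_le_of_lowerDerivate_le_on_density (hL : 0 ≤ L) (hnonneg : ∀ a b, 0 ≤ d a b)
    (hsymm : ∀ a b, d a b = d b a) (htri : ∀ a b c, d a c ≤ d a b + d b c)
    (hLip : ∀ a b, d a b ≤ L * ‖a - b‖) {x y v : EuclideanSpace ℝ (Fin n)} {c η r R T : ℝ}
    (hc : 0 ≤ c) (hr : 0 < r) (hR : ‖y - x‖ + r + |T| * ‖v‖ ≤ R)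
    (hη : (1 - η) * volume.real (ball x R) ≤
      volume.real ({z | lowerDerivate d z v ≤ c} ∩ ball x R)) :
    d y (y + T • v) ≤ 2 * L * r + |T| * (c + L * ‖v‖ * (η * (R / r) ^ n)) := by
  have hR0 : 0 < R := by
    have : 0 ≤ |T| * ‖v‖ := by positivity
    linarith [norm_nonneg (y - x)]
  set φ : EuclideanSpace ℝ (Fin n) → ℝ := fun w => d w y with hφdef
  have hφ : ∀ a b, |φ a - φ b| ≤ d a b := fun a b => by
    rw [abs_le]
    constructor <;> simp only [hφdef] <;> linarith [htri a b y, htri b a y, hsymm a b]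
  have hφL : LipschitzWith ⟨L, hL⟩ φ := LipschitzWith.of_dist_le_mul fun a b => by
    rw [Real.dist_eq, dist_eq_norm]
    exact (hφ a b).trans (hLip a b)
  have hfd : ∀ z, ‖fderiv ℝ φ z v‖ ≤ L * ‖v‖ := fun z =>
    ((fderiv ℝ φ z).le_opNorm v).trans
      (mul_le_mul_of_nonneg_right (norm_fderiv_le_of_lipschitz ℝ hφL) (norm_nonneg v))
  have hmeas : Measurable fun z => ‖fderiv ℝ φ z v‖ := (measurable_fderiv_apply_const ℝ φ v).norm
  set N : Set (EuclideanSpace ℝ (Fin n)) := {z | c < ‖fderiv ℝ φ z v‖}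
  have hN : MeasurableSet N := measurableSet_lt measurable_const hmeas
  have hNle : volume.real (ball x R ∩ N) ≤ η * volume.real (ball x R) := by
    refine measureReal_inter_le_of_ae_notMem hN ?_ measure_ball_lt_top.ne hη
    filter_upwards [hφL.ae_differentiableAt] with z hz hzc
    exact not_lt.2 ((norm_fderiv_apply_le_lowerDerivate hnonneg hLip hφ hz v).trans hzc)
  have hvol : volume.real (ball x R) = (R / r) ^ n * volume.real (ball y r) := by
    have h := Measure.addHaar_ball_mul_of_pos (volume : Measure (EuclideanSpace ℝ (Fin n))) x
      (div_pos hR0 hr) r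
    rw [div_mul_cancel₀ _ hr.ne', finrank_euclideanSpace_fin,
      ← Measure.addHaar_ball_center volume y r] at h
    rw [measureReal_def, h, ENNReal.toReal_mul, ENNReal.toReal_ofReal (by positivity),
      measureReal_def]
  have hV : 0 < volume.real (ball y r) :=
    ENNReal.toReal_pos (measure_ball_pos _ _ hr).ne' measure_ball_lt_top.ne
  have hfin : IsFiniteMeasure (volume.restrict (ball y r)) :=
    ⟨by simpa using measure_ball_lt_top⟩
  have hint := norm_setIntegral_translate_sub_le volume hφL v (S := ball y r)
    measure_ball_lt_top.ne T ((c + L * ‖v‖ * (η * (R / r) ^ n)) * volume.real (ball y r))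
    fun s hs => by
      set P := (fun w => w + s • v) ⁻¹' N
      have hPm : MeasurableSet P := (measurable_id.add_const _) hN
      have hbound : ∀ w, ‖fderiv ℝ φ (w + s • v) v‖ ≤ c + P.indicator (fun _ => L * ‖v‖) w := by
        intro w
        by_cases hw : w ∈ P
        · rw [indicator_of_mem hw]
          linarith [hfd (w + s • v)]
        · rw [indicator_of_notMem hw, add_zero]
          exact not_lt.1 hw
      have hPle : volume.real (ball y r ∩ P) ≤ volume.real (ball x R ∩ N) := by
        rw [measureReal_def, measureReal_def,
          ← measure_preimage_add_right volume (s • v) (ball x R ∩ N)]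
        refine ENNReal.toReal_mono ?_ (measure_mono fun w hw => ⟨?_, hw.2⟩)
        · rw [measure_preimage_add_right]
          exact measure_ne_top_of_subset inter_subset_left measure_ball_lt_top.ne
        · have h1 : ‖w - y‖ < r := by simpa [dist_eq_norm] using hw.1
          rw [mem_ball, dist_eq_norm]
          calc ‖w + s • v - x‖ = ‖(y - x) + (w - y) + s • v‖ := by congr 1; abel
            _ ≤ ‖y - x‖ + ‖w - y‖ + ‖s • v‖ := norm_add₃_le
            _ < R := by
              rw [norm_smul, Real.norm_eq_abs]
              linarith [mul_le_mul_of_nonneg_right hs (norm_nonneg v)]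
      have hind : Integrable (P.indicator fun _ => L * ‖v‖) (volume.restrict (ball y r)) :=
        (integrable_const _).indicator hPm
      calc ∫ w in ball y r, ‖fderiv ℝ φ (w + s • v) v‖
          ≤ ∫ w in ball y r, (c + P.indicator (fun _ => L * ‖v‖) w) :=
            integral_mono_of_nonneg (.of_forall fun _ => norm_nonneg _)
              ((integrable_const _).add hind) (.of_forall hbound)
        _ = c * volume.real (ball y r) + L * ‖v‖ * volume.real (ball y r ∩ P) := by
            rw [integral_add (integrable_const _) hind, integral_indicator_const _ hPm,
              setIntegral_const, measureReal_restrict_apply hPm, inter_comm, smul_eq_mul,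
              smul_eq_mul, mul_comm c, mul_comm (L * ‖v‖)]
        _ ≤ c * volume.real (ball y r) + L * ‖v‖ * (η * volume.real (ball x R)) := by
            gcongr
            exact hPle.trans hNle
        _ = _ := by rw [hvol]; ring
  have hlow : (d y (y + T • v) - 2 * L * r) * volume.real (ball y r) ≤
      ∫ w in ball y r, (φ (w + T • v) - φ w) := by
    rw [mul_comm, ← smul_eq_mul, ← setIntegral_const]
    refine setIntegral_mono_on (integrable_const _) ?_ measurableSet_ball fun w hw => ?_
    · refine (integrable_const (L * ‖T • v‖)).mono' (((hφL.continuous.comp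
        (continuous_id.add continuous_const)).sub hφL.continuous).aestronglyMeasurable)
        (.of_forall fun w => ?_)
      simpa using (hφ _ _).trans (hLip (w + T • v) w)
    · have hwy : ‖w - y‖ < r := by simpa [dist_eq_norm] using hw
      have h1 : d w y ≤ L * r := (hLip _ _).trans (mul_le_mul_of_nonneg_left hwy.le hL)
      have h2 : d (w + T • v) (y + T • v) ≤ L * r := by
        refine (hLip _ _).trans (mul_le_mul_of_nonneg_left ?_ hL)
        rw [add_sub_add_right_eq_sub]
        exact hwy.le
      simp only [hφdef]
      linarith [htri y (w + T • v) (y + T • v), hsymm y (w + T • v)]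
  have := hlow.trans ((le_abs_self _).trans hint)
  have : d y (y + T • v) - 2 * L * r ≤ (c + L * ‖v‖ * (η * (R / r) ^ n)) * |T| :=
    le_of_mul_le_mul_right (by linarith) hV
  linarith

end Derivates

/-- If `d` is a pseudometric on `ℝⁿ` that is `L`-Lipschitz with
respect to the Euclidean distance and `x` is an approximate continuity point of
`z ↦ ρ̲(z, v)`, then `ρ̄(x, τ•v) ≤ |τ| * ρ̲(x, v)` for every `τ`; in particular
`ρ̲(x, v) = ρ̄(x, v)`. -/
theorem upperDerivate_le_of_approxContinuity
    {n : ℕ} (L : ℝ) (hL : 0 < L)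
    (d : EuclideanSpace ℝ (Fin n) → EuclideanSpace ℝ (Fin n) → ℝ)
    (hsymm : ∀ a b, d a b = d b a)
    (hdiag : ∀ a, d a a = 0)
    (htri : ∀ a b c, d a c ≤ d a b + d b c)
    (hLip : ∀ a b, d a b ≤ L * ‖a - b‖)
    (v x : EuclideanSpace ℝ (Fin n))
    (happrox : ∀ ε : ℝ, 0 < ε →
      Filter.Tendsto
        (fun r : ℝ =>
          volume ({z | |lowerDerivate d z v - lowerDerivate d x v| < ε} ∩ ball x r) /
            volume (ball x r))
        (nhdsWithin 0 (Set.Ioi 0)) (nhds 1)) :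
    (∀ τ : ℝ, upperDerivate d x (τ • v) ≤ |τ| * lowerDerivate d x v) ∧
      lowerDerivate d x v = upperDerivate d x v := by
  have hnonneg : ∀ a b, 0 ≤ d a b := fun a b => by
    linarith [htri a b a, hdiag a, hsymm a b]
  have hρ := lowerDerivate_nonneg hnonneg hLip x v
  have hmain : ∀ τ : ℝ, upperDerivate d x (τ • v) ≤ |τ| * lowerDerivate d x v := by
    intro τ
    suffices h : ∀ ε > 0, upperDerivate d x (τ • v) ≤
        |τ| * lowerDerivate d x v + ε * (2 * L + |τ| * (1 + L * ‖v‖)) by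
      refine le_of_forall_pos_le_add fun e he => ?_
      have hK : 0 < 2 * L + |τ| * (1 + L * ‖v‖) := by positivity
      have := h (e / (2 * L + |τ| * (1 + L * ‖v‖))) (by positivity)
      rwa [div_mul_cancel₀ _ hK.ne'] at this
    intro ε hε
    set C := 1 + ε + |τ| * ‖v‖ with hC
    have hC0 : 0 < C := by positivity
    set η := ε / (C / ε) ^ n with hη
    have hη0 : 0 < η := by positivity
    have hdens : Tendsto (fun t : ℝ => C * t) (nhdsWithin 0 (Ioi 0)) (nhdsWithin 0 (Ioi 0)) := by
      refine tendsto_nhdsWithin_iff.2 ⟨?_, ?_⟩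
      · exact ((continuous_const.mul continuous_id).tendsto' (0 : ℝ) 0 (by simp)).mono_left
          nhdsWithin_le_nhds
      · filter_upwards [self_mem_nhdsWithin] with t ht using mul_pos hC0 ht
    have hev := ((happrox ε hε).comp hdens).eventually
      (lt_mem_nhds (show ENNReal.ofReal (1 - η) < 1 by
        rw [ENNReal.ofReal_lt_one]; linarith))
    refine upperDerivate_le hnonneg hLip ?_
    filter_upwards [hev, self_mem_nhdsWithin] with t ht (ht0 : 0 < t) y hy
    have hyx : ‖y - x‖ ≤ t := by simpa [dist_eq_norm] using hy
    have hr : 0 < ε * t := by positivity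
    have hdensity : (1 - η) * volume.real (ball x (C * t)) ≤ volume.real
        ({z | lowerDerivate d z v ≤ lowerDerivate d x v + ε} ∩ ball x (C * t)) := by
      have hV : 0 < volume.real (ball x (C * t)) :=
        ENNReal.toReal_pos (measure_ball_pos _ _ (by positivity)).ne' measure_ball_lt_top.ne
      have hfin : volume ({z | |lowerDerivate d z v - lowerDerivate d x v| < ε} ∩
          ball x (C * t)) / volume (ball x (C * t)) ≠ ⊤ :=
        ENNReal.div_ne_top (measure_ne_top_of_subset inter_subset_right measure_ball_lt_top.ne)
          (measure_ball_pos _ _ (by positivity)).ne'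
      have h1 := (ENNReal.ofReal_le_iff_le_toReal hfin).1 ht.le
      rw [ENNReal.toReal_div, ← measureReal_def, ← measureReal_def, le_div_iff₀ hV] at h1
      refine h1.trans (ENNReal.toReal_mono
        (measure_ne_top_of_subset inter_subset_right measure_ball_lt_top.ne)
        (measure_mono (inter_subset_inter_left _ fun z hz => ?_)))
      rw [mem_ofPred_eq, abs_lt] at hz
      rw [mem_ofPred_eq]
      linarith
    have h := dist_le_of_lowerDerivate_le_on_density hL.le hnonneg hsymm htri hLip (y := y)
      (T := t * τ) (by positivity) hr (by
        rw [abs_mul, abs_of_pos ht0, hC]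
        linarith) hdensity
    rw [mul_div_mul_right _ _ ht0.ne', hη, div_mul_cancel₀ _ (by positivity), abs_mul,
      abs_of_pos ht0] at h
    rw [smul_smul, div_le_iff₀ ht0]
    linarith
  refine ⟨hmain, le_antisymm (lowerDerivate_le_upperDerivate hnonneg hLip x v) ?_⟩
  simpa using hmain 1
end

section
/- There exists a Borel set 𝒰 ⊆ ℝⁿ whose complement has Lebesgue measure zero such that for every x ∈ 𝒰, every v ∈ ℝⁿ and every τ ∈ ℝ: ρ̲(x, v) = ρ̄(x, v) and ρ̄(x, τ·v) = |τ| · ρ̄(x, v). -/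
open Filter Metric Set MeasureTheory

open scoped Topology NNReal

section Differentiation

variable {E : Type*} [NormedAddCommGroup E] [NormedSpace ℝ E]

/-- The supremum of the absolute values of the directional derivatives of a family of functions. -/
noncomputable def supDeriv (f : ℕ → E → ℝ) (x v : E) : ℝ := ⨆ i, |fderiv ℝ (f i) x v|

variable {f : ℕ → E → ℝ} {C : ℝ≥0}

theorem abs_fderiv_apply_le (hf : ∀ i, LipschitzWith C (f i)) (i : ℕ) (x v : E) :
    |fderiv ℝ (f i) x v| ≤ C * ‖v‖ :=
  ((fderiv ℝ (f i) x).le_opNorm v).trans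
    (mul_le_mul_of_nonneg_right (norm_fderiv_le_of_lipschitz ℝ (hf i)) (norm_nonneg v))

theorem abs_fderiv_le_supDeriv (hf : ∀ i, LipschitzWith C (f i)) (i : ℕ) (x v : E) :
    |fderiv ℝ (f i) x v| ≤ supDeriv f x v :=
  le_ciSup (f := fun i => |fderiv ℝ (f i) x v|)
    ⟨C * ‖v‖, forall_mem_range.2 fun i => abs_fderiv_apply_le hf i x v⟩ i

theorem supDeriv_smul (f : ℕ → E → ℝ) (x v : E) (τ : ℝ) :
    supDeriv f x (τ • v) = |τ| * supDeriv f x v := by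
  simp only [supDeriv, map_smul, smul_eq_mul, abs_mul, Real.mul_iSup_of_nonneg (abs_nonneg τ)]

theorem supDeriv_le_add (hf : ∀ i, LipschitzWith C (f i)) (x v w : E) :
    supDeriv f x v ≤ supDeriv f x w + C * ‖v - w‖ := by
  refine ciSup_le fun i => ?_
  have h : fderiv ℝ (f i) x v = fderiv ℝ (f i) x w + fderiv ℝ (f i) x (v - w) := by
    simp [map_sub]
  rw [h]
  exact (abs_add_le _ _).trans
    (add_le_add (abs_fderiv_le_supDeriv hf i x w) (abs_fderiv_apply_le hf i x _))

theorem abs_supDeriv_sub_le (hf : ∀ i, LipschitzWith C (f i)) (x v w : E) :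
    |supDeriv f x v - supDeriv f x w| ≤ C * ‖v - w‖ := by
  have h1 := supDeriv_le_add hf x v w
  have h2 := supDeriv_le_add hf x w v
  rw [norm_sub_rev] at h2
  rw [abs_le]
  constructor <;> linarith

/-- At a differentiability point of a family of functions, the increments of some member of the
family are bounded from below by `supDeriv`. -/
theorem eventually_exists_le_abs_sub {x : E} (hx : ∀ i, DifferentiableAt ℝ (f i) x) (v : E)
    {η : ℝ} (hη : 0 < η) :
    ∀ᶠ t in 𝓝[>] (0 : ℝ), ∀ y ∈ closedBall x t, ∃ i,
      t * (supDeriv f x v - η) ≤ |f i (y + t • v) - f i y| := by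
  obtain ⟨i, hi⟩ := exists_lt_of_lt_ciSup (f := fun i => |fderiv ℝ (f i) x v|)
    (show supDeriv f x v - η / 2 < _ from sub_lt_self _ (half_pos hη))
  set c : ℝ := η / (4 * (1 + ‖v‖)) with hc
  have hcpos : 0 < c := by positivity
  have hcv : c * (1 + ‖v‖) = η / 4 := by rw [hc]; field_simp
  have ho := (hx i).hasFDerivAt.isLittleO.def hcpos
  obtain ⟨δ, hδ, hball⟩ := Metric.eventually_nhds_iff_ball.1 ho
  have hδ' : 0 < δ / (1 + ‖v‖) := by positivity
  filter_upwards [Ioo_mem_nhdsGT hδ'] with t ht y hy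
  have hsmall : t * (1 + ‖v‖) < δ := (lt_div_iff₀ (by positivity)).1 ht.2
  have htpos := ht.1
  rw [mem_closedBall, dist_eq_norm] at hy
  have key (p : E) (hp : ‖p - x‖ ≤ t * (1 + ‖v‖)) :
      |f i p - f i x - fderiv ℝ (f i) x (p - x)| ≤ t * (η / 4) := by
    refine (hball p (by rw [mem_ball, dist_eq_norm]; linarith)).trans ?_
    rw [← hcv]
    nlinarith
  have h1 := abs_le.1 (key y (by nlinarith [norm_nonneg v]))
  have h2 := abs_le.1 (key (y + t • v) (by
    calc ‖y + t • v - x‖ = ‖(y - x) + t • v‖ := by congr 1; abel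
      _ ≤ ‖y - x‖ + ‖t • v‖ := norm_add_le _ _
      _ ≤ t + t * ‖v‖ := by rw [norm_smul, Real.norm_of_nonneg htpos.le]; gcongr
      _ = t * (1 + ‖v‖) := by ring))
  have h3 : fderiv ℝ (f i) x (y + t • v - x)
      = fderiv ℝ (f i) x (y - x) + t * fderiv ℝ (f i) x v := by
    rw [show y + t • v - x = (y - x) + t • v by abel, map_add, map_smul, smul_eq_mul]
  rw [h3] at h2
  refine ⟨i, ?_⟩
  have h4 : t * |fderiv ℝ (f i) x v| ≤ |f i (y + t • v) - f i y| + t * (η / 2) := by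
    rw [← abs_of_pos htpos, ← abs_mul, abs_of_pos htpos]
    refine abs_le.2 ⟨?_, ?_⟩
    · linarith [neg_abs_le (f i (y + t • v) - f i y)]
    · linarith [le_abs_self (f i (y + t • v) - f i y)]
  nlinarith

variable [FiniteDimensional ℝ E] [MeasurableSpace E] [BorelSpace E]

/-- If the averages of a function `g` bounding the directional derivative of a Lipschitz function
`f` are at most `M` on all balls of radius `r` centred on a segment, then `f` varies by at most
`t * M` along the segment, up to an error `2 * C * r`. -/
theorem LipschitzWith.abs_sub_le_of_average_le (μ : Measure E) [μ.IsAddHaarMeasure]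
    {f g : E → ℝ} {C : ℝ≥0} (hf : LipschitzWith C f) (hg : LocallyIntegrable g μ) {v : E}
    (hfg : ∀ᵐ x ∂μ, |fderiv ℝ f x v| ≤ g x) {y : E} {t r M : ℝ} (ht : 0 ≤ t) (hr : 0 < r)
    (hM : ∀ s ∈ Icc 0 t, ⨍ z in closedBall (y + s • v) r, g z ∂μ ≤ M) :
    |f (y + t • v) - f y| ≤ t * M + 2 * C * r := by
  set B : Set E := closedBall 0 r with hB
  set V : ℝ := μ.real B with hV
  have hVpos : 0 < V := ENNReal.toReal_pos (measure_closedBall_pos μ 0 hr).ne'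
    measure_closedBall_lt_top.ne
  have hfin : μ B < ⊤ := measure_closedBall_lt_top
  have hf_int (p : E) : IntegrableOn (fun z => f (p + z)) B μ :=
    (hf.continuous.comp (continuous_const.add continuous_id)).continuousOn.integrableOn_compact
      (isCompact_closedBall 0 r)
  have hderiv (s : ℝ) : HasDerivAt (fun s : ℝ => ∫ z in B, f (y + s • v + z) ∂μ)
      (∫ z in B, fderiv ℝ f (y + s • v + z) v ∂μ) s := by
    refine (hasDerivAt_integral_of_dominated_loc_of_lip (bound := fun _ => C * ‖v‖)
      univ_mem ?_ (hf_int (y + s • v)).integrable ?_ ?_ ?_ ?_).2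
    · exact Eventually.of_forall fun s => (hf_int _).aestronglyMeasurable
    · exact ((measurable_fderiv_apply_const ℝ f v).comp
        (measurable_const_add (y + s • v))).aestronglyMeasurable
    · refine Eventually.of_forall fun z => LipschitzOnWith.of_dist_le_mul fun a _ b _ => ?_
      refine (hf.dist_le_mul _ _).trans (le_of_eq ?_)
      rw [Real.coe_nnabs, abs_of_nonneg (by positivity), dist_add_right, dist_add_left,
        dist_eq_norm, ← sub_smul, norm_smul, dist_eq_norm]
      ring
    · exact integrableOn_const hfin.ne
    · refine ae_restrict_of_ae ?_
      have := (quasiMeasurePreserving_add_left μ (y + s • v)).ae (hf.ae_differentiableAt (μ := μ))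
      filter_upwards [this] with z hz
      have h1 : HasDerivAt (fun s : ℝ => y + s • v + z) v s := by
        simpa using (((hasDerivAt_id s).smul_const v).const_add y).add_const z
      exact hz.hasFDerivAt.comp_hasDerivAt s h1
  have hbound (s : ℝ) (hs : s ∈ Ico 0 t) :
      ‖∫ z in B, fderiv ℝ f (y + s • v + z) v ∂μ‖ ≤ V * M := by
    have himg : (fun z => y + s • v + z) ⁻¹' closedBall (y + s • v) r = B := by
      ext z; simp [hB]
    have hmp := measurePreserving_add_left μ (y + s • v)
    have hemb := measurableEmbedding_addLeft (y + s • v)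
    have h1 : ∫ z in B, g (y + s • v + z) ∂μ = ∫ z in closedBall (y + s • v) r, g z ∂μ := by
      rw [← himg]; exact hmp.setIntegral_preimage_emb hemb g _
    have h2 : μ.real (closedBall (y + s • v) r) = V := by
      simp [hV, hB, measureReal_def, Measure.addHaar_closedBall_center μ (y + s • v) r]
    have h3 : IntegrableOn (fun z => g (y + s • v + z)) B μ := by
      rw [← himg]
      exact (hmp.integrableOn_comp_preimage hemb).2
        (hg.integrableOn_isCompact (isCompact_closedBall _ _))
    have h4 := hM s (Ico_subset_Icc_self hs)
    rw [setAverage_eq, h2, smul_eq_mul, ← h1, inv_mul_le_iff₀ hVpos] at h4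
    refine le_trans ?_ h4
    refine norm_integral_le_of_norm_le h3 (ae_restrict_of_ae ?_)
    exact (quasiMeasurePreserving_add_left μ (y + s • v)).ae hfg
  have hmvt := norm_image_sub_le_of_norm_deriv_le_segment'
    (fun s _ => (hderiv s).hasDerivWithinAt) hbound t (right_mem_Icc.2 ht)
  have hsmear : ‖∫ z in B, ((f (y + t • v) - f y) - (f (y + t • v + z) - f (y + z))) ∂μ‖
      ≤ 2 * C * r * V := by
    refine norm_setIntegral_le_of_norm_le_const hfin fun z hz => ?_
    have hz : ‖z‖ ≤ r := by simpa [hB] using hz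
    have h1 (p : E) : |f p - f (p + z)| ≤ C * r := by
      have := hf.dist_le_mul p (p + z)
      rw [Real.dist_eq, dist_self_add_right] at this
      exact this.trans (by gcongr)
    rw [Real.norm_eq_abs, abs_le]
    have h2 := abs_le.1 (h1 (y + t • v))
    have h3 := abs_le.1 (h1 y)
    constructor <;> linarith [h2.1, h2.2, h3.1, h3.2]
  have hdiff : Integrable (fun z => f (y + t • v + z) - f (y + z)) (μ.restrict B) :=
    (hf_int _).sub (hf_int _)
  rw [integral_sub (integrable_const_iff.2 (.inr ⟨by simpa using hfin⟩)) hdiff,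
    integral_sub (hf_int _).integrable (hf_int _).integrable, setIntegral_const,
    smul_eq_mul] at hsmear
  simp only [zero_smul, add_zero, sub_zero] at hmvt
  rw [Real.norm_eq_abs] at hmvt hsmear
  have h5 : |V * (f (y + t • v) - f y)| ≤ V * (t * M + 2 * C * r) := by
    rw [abs_le] at *
    constructor <;> nlinarith [hmvt.1, hmvt.2, hsmear.1, hsmear.2]
  rw [abs_mul, abs_of_pos hVpos] at h5
  exact le_of_mul_le_mul_left h5 hVpos

/-- Lebesgue differentiation, uniformly over the balls of radius `r` at distance `O(r)` from the
point. -/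
theorem MeasureTheory.LocallyIntegrable.ae_eventually_forall_abs_average_sub_lt
    (μ : Measure E) [μ.IsAddHaarMeasure] {g : E → ℝ} (hg : LocallyIntegrable g μ) (K : ℝ) :
    ∀ᵐ x ∂μ, ∀ η > 0, ∀ᶠ r in 𝓝[>] (0 : ℝ), ∀ w, x ∈ closedBall w (K * r) →
      |⨍ z in closedBall w r, g z ∂μ - g x| < η := by
  filter_upwards [IsUnifLocDoublingMeasure.ae_tendsto_average μ hg K] with x hx η hη
  have h := hx (l := (𝓝[>] (0 : ℝ) ×ˢ 𝓟 (univ : Set E)) ⊓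
      𝓟 {p : ℝ × E | x ∈ closedBall p.2 (K * p.1)}) Prod.snd Prod.fst
    (tendsto_fst.mono_left inf_le_left) (mem_inf_of_right (mem_principal_self _))
  have h' := h (ball_mem_nhds _ hη)
  rw [mem_map, mem_inf_principal] at h'
  filter_upwards [eventually_prod_principal_iff.1 h'] with r hr w hw
  simpa [Real.dist_eq] using hr w (mem_univ _) hw

theorem locallyIntegrable_supDeriv (μ : Measure E) [μ.IsAddHaarMeasure]
    (hf : ∀ i, LipschitzWith C (f i)) (v : E) :
    LocallyIntegrable (fun x => supDeriv f x v) μ := by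
  have hmeas : Measurable fun x => supDeriv f x v :=
    Measurable.iSup fun i => (measurable_fderiv_apply_const ℝ (f i) v).abs
  refine (locallyIntegrable_const (C * ‖v‖ : ℝ)).mono hmeas.aestronglyMeasurable
    (Eventually.of_forall fun x => ?_)
  rw [Real.norm_eq_abs, Real.norm_eq_abs,
    abs_of_nonneg (show 0 ≤ supDeriv f x v from Real.iSup_nonneg fun _ => abs_nonneg _)]
  exact (ciSup_le fun i => abs_fderiv_apply_le hf i x v).trans (le_abs_self _)

/-- Almost everywhere, `supDeriv` bounds from above, uniformly in the index, the increments of the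
family at small scales. -/
theorem ae_eventually_abs_sub_le_supDeriv (μ : Measure E) [μ.IsAddHaarMeasure]
    (hf : ∀ i, LipschitzWith C (f i)) (v : E) :
    ∀ᵐ x ∂μ, ∀ η > 0, ∀ᶠ t in 𝓝[>] (0 : ℝ), ∀ y ∈ closedBall x t, ∀ i,
      |f i (y + t • v) - f i y| ≤ t * (supDeriv f x v + η) := by
  have hg := locallyIntegrable_supDeriv μ hf v
  filter_upwards [ae_all_iff.2 fun K : ℕ => hg.ae_eventually_forall_abs_average_sub_lt μ K]
    with x hx η hη
  set ε : ℝ := η / (4 * (C + 1)) with hε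
  have hεpos : 0 < ε := by positivity
  have hCε : 2 * C * ε ≤ η / 2 := by
    rw [hε, ← mul_div_assoc, div_le_iff₀ (by positivity)]
    nlinarith [C.coe_nonneg]
  obtain ⟨K, hK⟩ := exists_nat_ge ((1 + ‖v‖) / ε)
  rw [div_le_iff₀ hεpos] at hK
  have hlim : Tendsto (fun t : ℝ => ε * t) (𝓝[>] 0) (𝓝[>] 0) := by
    refine tendsto_nhdsWithin_iff.2 ⟨?_, ?_⟩
    · have : Tendsto (fun t : ℝ => ε * t) (𝓝 0) (𝓝 (ε * 0)) :=
        (continuous_const_mul ε).tendsto 0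
      rw [mul_zero] at this
      exact this.mono_left nhdsWithin_le_nhds
    · filter_upwards [self_mem_nhdsWithin] with t ht using mul_pos hεpos ht
  filter_upwards [hlim.eventually (hx K (η / 2) (half_pos hη)), self_mem_nhdsWithin]
    with t ht htpos y hy i
  have htpos : 0 < t := htpos
  refine ((hf i).abs_sub_le_of_average_le μ hg
    (Eventually.of_forall fun z => abs_fderiv_le_supDeriv hf i z v) htpos.le
    (mul_pos hεpos htpos) (M := supDeriv f x v + η / 2) fun s hs => ?_).trans ?_
  · have hmem : x ∈ closedBall (y + s • v) (K * (ε * t)) := by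
      rw [mem_closedBall, dist_comm] at *
      calc dist (y + s • v) x ≤ dist (y + s • v) y + dist y x := dist_triangle _ _ _
        _ ≤ t * ‖v‖ + t := by
          gcongr
          · rw [dist_self_add_left, norm_smul, Real.norm_of_nonneg hs.1]
            gcongr
            exact hs.2
          · rwa [dist_comm]
        _ = (1 + ‖v‖) * t := by ring
        _ ≤ K * ε * t := by gcongr
        _ = K * (ε * t) := by ring
    linarith [(abs_lt.1 (ht _ hmem)).2]
  · nlinarith

end Differentiation

section Pseudometric

variable {E : Type*} [NormedAddCommGroup E] [NormedSpace ℝ E]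

/-- The difference quotients `d y (y + t • v) / t` with `y` in the closed ball of radius `t` about
`x` converge to `a` as `t → 0⁺`, uniformly in `y`. -/
def HasUniformDerivate (d : E → E → ℝ) (x v : E) (a : ℝ) : Prop :=
  ∀ η > 0, ∀ᶠ t in 𝓝[>] (0 : ℝ), ∀ y ∈ closedBall x t, |d y (y + t • v) / t - a| ≤ η

theorem HasUniformDerivate.lowerDerivate_eq {n : ℕ}
    {d : EuclideanSpace ℝ (Fin n) → EuclideanSpace ℝ (Fin n) → ℝ}
    {x v : EuclideanSpace ℝ (Fin n)} {a : ℝ} (h : HasUniformDerivate d x v a) :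
    lowerDerivate d x v = a := by
  refine Tendsto.liminf_eq (Metric.tendsto_nhds.2 fun ε hε => ?_)
  filter_upwards [h (ε / 2) (half_pos hε), self_mem_nhdsWithin] with t ht htpos
  have hx : x ∈ closedBall x t := mem_closedBall_self (le_of_lt htpos)
  have hlow : ∀ b ∈ (fun y => d y (y + t • v) / t) '' closedBall x t, a - ε / 2 ≤ b :=
    forall_mem_image.2 fun y hy => by linarith [(abs_le.1 (ht y hy)).1]
  have h1 := le_csInf ⟨_, mem_image_of_mem _ hx⟩ hlow
  have h2 := csInf_le ⟨_, hlow⟩ (mem_image_of_mem _ hx)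
  rw [Real.dist_eq, abs_lt]
  constructor <;> linarith [(abs_le.1 (ht x hx)).2]

theorem HasUniformDerivate.upperDerivate_eq {n : ℕ}
    {d : EuclideanSpace ℝ (Fin n) → EuclideanSpace ℝ (Fin n) → ℝ}
    {x v : EuclideanSpace ℝ (Fin n)} {a : ℝ} (h : HasUniformDerivate d x v a) :
    upperDerivate d x v = a := by
  refine Tendsto.limsup_eq (Metric.tendsto_nhds.2 fun ε hε => ?_)
  filter_upwards [h (ε / 2) (half_pos hε), self_mem_nhdsWithin] with t ht htpos
  have hx : x ∈ closedBall x t := mem_closedBall_self (le_of_lt htpos)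
  have hup : ∀ b ∈ (fun y => d y (y + t • v) / t) '' closedBall x t, b ≤ a + ε / 2 :=
    forall_mem_image.2 fun y hy => by linarith [(abs_le.1 (ht y hy)).2]
  have h1 := csSup_le ⟨_, mem_image_of_mem _ hx⟩ hup
  have h2 := le_csSup ⟨_, hup⟩ (mem_image_of_mem _ hx)
  rw [Real.dist_eq, abs_lt]
  constructor <;> linarith [(abs_le.1 (ht x hx)).1]

variable {L : ℝ} {d : E → E → ℝ}

theorem abs_sub_le_of_pseudometric {X : Type*} {d : X → X → ℝ} (hsymm : ∀ a b, d a b = d b a)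
    (htri : ∀ a b c, d a c ≤ d a b + d b c) (p q z : X) : |d p z - d q z| ≤ d p q := by
  rw [abs_le]
  constructor <;> linarith [htri p q z, htri q p z, hsymm p q]

theorem lipschitzWith_of_pseudometric {X : Type*} [SeminormedAddCommGroup X] {d : X → X → ℝ}
    (hL : 0 < L) (hsymm : ∀ a b, d a b = d b a) (htri : ∀ a b c, d a c ≤ d a b + d b c)
    (hLip : ∀ a b, d a b ≤ L * ‖a - b‖) (z : X) :
    LipschitzWith L.toNNReal fun y => d y z :=
  LipschitzWith.of_dist_le_mul fun p q => by
    rw [Real.dist_eq, dist_eq_norm, Real.coe_toNNReal L hL.le]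
    exact (abs_sub_le_of_pseudometric hsymm htri p q z).trans (hLip p q)

/-- Uniform derivates of a Lipschitz pseudometric in a dense set of directions determine those in
all directions. -/
theorem hasUniformDerivate_of_dense (hL : 0 < L) (hsymm : ∀ a b, d a b = d b a)
    (htri : ∀ a b c, d a c ≤ d a b + d b c) (hLip : ∀ a b, d a b ≤ L * ‖a - b‖)
    {x : E} {N : E → ℝ} (hN : ∀ v w, |N v - N w| ≤ L * ‖v - w‖) {u : ℕ → E} (hu : DenseRange u)
    (h : ∀ k, HasUniformDerivate d x (u k) (N (u k))) (v : E) :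
    HasUniformDerivate d x v (N v) := by
  intro η hη
  obtain ⟨k, hk⟩ := hu.exists_dist_lt v (show 0 < η / (3 * L) by positivity)
  rw [dist_eq_norm, lt_div_iff₀ (by positivity)] at hk
  filter_upwards [h k (η / 3) (by positivity), self_mem_nhdsWithin] with t ht htpos y hy
  have htpos : 0 < t := htpos
  have h1 : |d y (y + t • v) / t - d y (y + t • u k) / t| ≤ L * ‖v - u k‖ := by
    rw [← sub_div, abs_div, abs_of_pos htpos, div_le_iff₀ htpos, hsymm y, hsymm y]
    refine (abs_sub_le_of_pseudometric hsymm htri _ _ y).trans ((hLip _ _).trans (le_of_eq ?_))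
    rw [add_sub_add_left_eq_sub, ← smul_sub, norm_smul, Real.norm_of_nonneg htpos.le]
    ring
  have h1 := abs_le.1 h1
  have h2 := abs_le.1 (ht y hy)
  have h3 := abs_le.1 (hN v (u k))
  rw [abs_le]
  constructor <;> linarith [h1.1, h1.2, h2.1, h2.2, h3.1, h3.2]

variable [FiniteDimensional ℝ E] [MeasurableSpace E] [BorelSpace E]

theorem ae_hasUniformDerivate (μ : Measure E) [μ.IsAddHaarMeasure] (hL : 0 < L)
    (hsymm : ∀ a b, d a b = d b a) (htri : ∀ a b c, d a c ≤ d a b + d b c)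
    (hLip : ∀ a b, d a b ≤ L * ‖a - b‖) {u : ℕ → E} (hu : DenseRange u) (v : E) :
    ∀ᵐ x ∂μ, HasUniformDerivate d x v (supDeriv (fun i y => d y (u i)) x v) := by
  have hf (i : ℕ) := lipschitzWith_of_pseudometric hL hsymm htri hLip (u i)
  filter_upwards [ae_eventually_abs_sub_le_supDeriv μ hf v,
    ae_all_iff.2 fun i => (hf i).ae_differentiableAt (μ := μ)] with x hup hdiff η hη
  filter_upwards [hup (η / 2) (half_pos hη), eventually_exists_le_abs_sub hdiff v hη,
    self_mem_nhdsWithin] with t hle hge htpos y hy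
  have htpos : 0 < t := htpos
  obtain ⟨i, hi⟩ := hge y hy
  have hi' := abs_sub_le_of_pseudometric hsymm htri (y + t • v) y (u i)
  obtain ⟨j, hj⟩ := hu.exists_dist_lt y (show 0 < t * η / (4 * L) by positivity)
  rw [dist_eq_norm, lt_div_iff₀ (by positivity)] at hj
  have h1 := htri y (u j) (y + t • v)
  have h2 := (le_abs_self _).trans (hle y hy j)
  have h3 := hLip y (u j)
  rw [hsymm (y + t • v) y] at hi'
  rw [hsymm (u j)] at h1
  rw [abs_le, neg_le_sub_iff_le_add, sub_le_iff_le_add, div_le_iff₀ htpos, ← sub_le_iff_le_add,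
    le_div_iff₀ htpos]
  constructor <;> nlinarith

end Pseudometric

/-- For a pseudometric `d` on `ℝⁿ` which is `L`-Lipschitz with
respect to the Euclidean distance, there is a Borel set `𝒰 ⊆ ℝⁿ` of full
Lebesgue measure on which the lower and upper derivates agree and are
absolutely homogeneous in the direction variable. -/
theorem metric_regular_points_full_measure
    {n : ℕ} (L : ℝ) (hL : 0 < L)
    (d : EuclideanSpace ℝ (Fin n) → EuclideanSpace ℝ (Fin n) → ℝ)
    (hsymm : ∀ a b, d a b = d b a)
    (hdiag : ∀ a, d a a = 0)
    (htri : ∀ a b c, d a c ≤ d a b + d b c)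
    (hLip : ∀ a b, d a b ≤ L * ‖a - b‖) :
    ∃ 𝒰 : Set (EuclideanSpace ℝ (Fin n)), MeasurableSet 𝒰 ∧ volume 𝒰ᶜ = 0 ∧
      ∀ x ∈ 𝒰, ∀ v : EuclideanSpace ℝ (Fin n), ∀ τ : ℝ,
        lowerDerivate d x v = upperDerivate d x v ∧
          upperDerivate d x (τ • v) = |τ| * upperDerivate d x v := by
  let E := EuclideanSpace ℝ (Fin n)
  let u : ℕ → E := TopologicalSpace.denseSeq E
  have hu : DenseRange u := TopologicalSpace.denseRange_denseSeq E
  obtain ⟨𝒰, hmem, hmeas, h𝒰⟩ := (ae_all_iff.2 fun k =>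
    ae_hasUniformDerivate volume hL hsymm htri hLip hu (u k)).exists_measurable_mem
  refine ⟨𝒰, hmeas, mem_ae_iff.1 hmem, fun x hx v τ => ?_⟩
  have hN (v w : E) := abs_supDeriv_sub_le
    (fun i => lipschitzWith_of_pseudometric hL hsymm htri hLip (u i)) x v w
  rw [Real.coe_toNNReal L hL.le] at hN
  have h := hasUniformDerivate_of_dense hL hsymm htri hLip hN hu (h𝒰 x hx)
  rw [(h v).lowerDerivate_eq, (h v).upperDerivate_eq, (h (τ • v)).upperDerivate_eq]
  exact ⟨rfl, supDeriv_smul _ x v τ⟩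
end
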